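/- The Fourier transform of W(x) = (1/(2π)) log|coth(x/2)| on ℝ is Ŵ(ξ) = (1/(2ξ)) tanh(πξ/2) for ξ ≠ 0. -/

import Mathlib

open MeasureTheory
/-- The interaction kernel on the hyperbolic plane reduced to a geodesic. -/
noncomputable def Whyper (x : ℝ) : ℝ :=
  (1 / (2 * Real.pi)) * Real.log |Real.cosh (x / 2) / Real.sinh (x / 2)|


lemma hyp_S (ξ : ℝ) (hξ : ξ ≠ 0) :
    HasSum (fun n : ℕ => 1 / (((n:ℝ) + 1)^2 + ξ^2))
      (Real.pi * Real.cosh (Real.pi * ξ) / Real.sinh (Real.pi * ξ) / (2*ξ) - 1 / (2*ξ^2)) := by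
  have hx : Complex.I * ξ ∈ Complex.integerComplement := by
    rw [Complex.mem_integerComplement_iff]
    rintro ⟨n, hn⟩
    have := congrArg Complex.im hn
    simp at this
    exact hξ this.symm
  have h1 := (summable_cotTerm hx).hasSum
  have h2 := cot_series_rep' hx
  have h2' : (∑' n : ℕ, cotTerm (Complex.I * ξ) n)
      = Real.pi * Complex.cot (Real.pi * (Complex.I * ξ)) - 1 / (Complex.I * ξ) := h2.symm
  rw [h2'] at h1
  have hξ' : (ξ : ℂ) ≠ 0 := by exact_mod_cast hξ
  have hs : Real.sinh (Real.pi * ξ) ≠ 0 := by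
    simp [Real.sinh_eq_zero, hξ, Real.pi_ne_zero]
  have hs' : Complex.sinh (Real.pi * ξ) ≠ 0 := by exact_mod_cast hs
  have h3 := h1.mul_left (Complex.I / (2 * ξ))
  rw [← Complex.hasSum_ofReal]
  convert! h3 using 1
  · ext n
    have hd : (((n:ℂ) + 1)^2 + (ξ:ℂ)^2) ≠ 0 := by
      have : ((n:ℝ) + 1)^2 + ξ^2 ≠ 0 := by positivity
      exact_mod_cast this
    have e : (((n:ℂ) + 1)^2 + (ξ:ℂ)^2) = -((Complex.I * ξ + (n+1)) * (Complex.I * ξ - (n+1))) := by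
      linear_combination (-(ξ:ℂ)^2) * (-Complex.I_sq)
    rw [cotTerm_identity hx]
    push_cast
    rw [e] at hd ⊢
    have hd' := neg_ne_zero.mp hd
    have := left_ne_zero_of_mul hd'
    have := right_ne_zero_of_mul hd'
    field_simp
    linear_combination -Complex.I_sq
  · rw [Complex.cot_eq_cos_div_sin, show (Real.pi : ℂ) * (Complex.I * ξ) = (Real.pi * ξ) * Complex.I by ring,
      Complex.cos_mul_I, Complex.sin_mul_I]
    push_cast
    field_simp

lemma hyp_odd (ξ : ℝ) (hξ : ξ ≠ 0) :
    HasSum (fun n : ℕ => 1 / ((2 * (n:ℝ) + 1)^2 + ξ^2))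
      (Real.pi / (4 * ξ) * Real.tanh (Real.pi * ξ / 2)) := by
  have hA := hyp_S ξ hξ
  have hB := (hyp_S (ξ/2) (by simpa using hξ)).mul_left (1/4)
  have hsum : Summable (fun n : ℕ => 1 / ((2 * (n:ℝ) + 1)^2 + ξ^2)) := by
    have := hA.summable.comp_injective (i := fun n : ℕ => 2 * n) (fun a b h => by simpa using h)
    convert! this using 1; ext n
    simp
  have hAll := HasSum.even_add_odd (f := fun n : ℕ => 1 / (((n:ℝ) + 1)^2 + ξ^2))
    (m := ∑' n : ℕ, 1 / ((2 * (n:ℝ) + 1)^2 + ξ^2))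
    (by convert! hsum.hasSum using 1; ext n; simp)
    (by
      convert! hB using 1; ext n
      push_cast
      have : ((n:ℝ)+1)^2 + (ξ/2)^2 ≠ 0 := by positivity
      have : (2 * (n:ℝ)+1+1)^2 + ξ^2 ≠ 0 := by positivity
      field_simp
      ring)
  have := hA.unique hAll
  convert! hsum.hasSum using 1
  set y := Real.pi * ξ / 2 with hy
  have e1 : Real.pi * ξ = 2 * y := by rw [hy]; ring
  have e2 : Real.pi * (ξ/2) = y := by rw [hy]; ring
  rw [e1, e2, Real.cosh_two_mul, Real.sinh_two_mul] at this
  rw [Real.tanh_eq_sinh_div_cosh]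
  have hy0 : y ≠ 0 := by rw [hy]; have := Real.pi_ne_zero; positivity
  have hs : Real.sinh y ≠ 0 := by simpa [Real.sinh_eq_zero] using hy0
  have hc : Real.cosh y ≠ 0 := (Real.cosh_pos y).ne'
  rw [← sub_eq_iff_eq_add] at this
  rw [← this]
  field_simp
  ring

lemma hyp_int (a ξ : ℝ) (ha : 0 < a) :
    Integrable (fun x : ℝ => (Real.exp (-a * |x|) : ℂ) * Complex.exp (-Complex.I * ξ * x)) ∧
    ∫ x : ℝ, (Real.exp (-a * |x|) : ℂ) * Complex.exp (-Complex.I * ξ * x)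
      = ((2 * a * (1 / (a^2 + ξ^2)) : ℝ) : ℂ) := by
  have r1 : (-a - Complex.I * ξ : ℂ).re < 0 := by simpa using ha
  have r2 : 0 < (a - Complex.I * ξ : ℂ).re := by simpa using ha
  have c1 : Set.EqOn (fun x : ℝ => Complex.exp ((-a - Complex.I * ξ : ℂ) * x))
      (fun x : ℝ => (Real.exp (-a * |x|) : ℂ) * Complex.exp (-Complex.I * ξ * x)) (Set.Ioi 0) := by
    intro x hx
    simp only
    rw [abs_of_pos hx, Complex.ofReal_exp, ← Complex.exp_add]
    push_cast; ring_nf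
  have c2 : Set.EqOn (fun x : ℝ => Complex.exp ((a - Complex.I * ξ : ℂ) * x))
      (fun x : ℝ => (Real.exp (-a * |x|) : ℂ) * Complex.exp (-Complex.I * ξ * x)) (Set.Iic 0) := by
    intro x hx
    simp only
    rw [abs_of_nonpos hx, Complex.ofReal_exp, ← Complex.exp_add]
    push_cast; ring_nf
  have i1 := (integrableOn_exp_mul_complex_Ioi r1 0).congr_fun c1 measurableSet_Ioi
  have i2 := (integrableOn_exp_mul_complex_Iic r2 0).congr_fun c2 measurableSet_Iic
  refine ⟨?_, ?_⟩
  · rw [← integrableOn_univ, ← Set.Iic_union_Ioi (a := (0:ℝ))]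
    exact i2.union i1
  · rw [← intervalIntegral.integral_Iic_add_Ioi i2 i1, ← setIntegral_congr_fun measurableSet_Ioi c1,
      ← setIntegral_congr_fun measurableSet_Iic c2, integral_exp_mul_complex_Ioi r1,
      integral_exp_mul_complex_Iic r2]
    have n1 : (a - Complex.I * ξ : ℂ) ≠ 0 := fun h => by rw [h] at r2; simp at r2
    have n2 : (a + Complex.I * ξ : ℂ) ≠ 0 := fun h => by
      have := congrArg Complex.re h
      simp at this; exact ha.ne' this
    have e : ((a:ℂ)^2 + (ξ:ℂ)^2) = (a - Complex.I * ξ) * (a + Complex.I * ξ) := by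
      linear_combination (-(ξ:ℂ)^2) * (-Complex.I_sq)
    push_cast
    rw [e, show (-a - Complex.I * ξ : ℂ) = -(a + Complex.I * ξ) by ring]
    simp only [mul_zero, Complex.exp_zero]
    field_simp
    ring

lemma hyp_W (x : ℝ) (hx : x ≠ 0) :
    HasSum (fun n : ℕ => 1 / (Real.pi * (2 * n + 1)) * Real.exp (-(2 * n + 1) * |x|)) (Whyper x) := by
  have hax : 0 < |x| := abs_pos.mpr hx
  have hq : Real.exp (-|x|) < 1 := by rw [Real.exp_lt_one_iff]; linarith
  have hq0 := Real.exp_pos (-|x|)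
  have h := (Real.hasSum_log_sub_log_of_abs_lt_one (x := Real.exp (-|x|))
    (by rwa [abs_of_pos hq0])).mul_left (1 / (2 * Real.pi))
  convert! h using 1
  · ext n
    rw [← Real.exp_nat_mul]
    push_cast
    rw [show (2 * (n:ℝ) + 1) * -|x| = -(2 * n + 1) * |x| by ring]
    have := Real.pi_ne_zero
    field_simp
  · rw [Whyper, ← Real.log_div (by linarith) (by linarith)]
    congr 2
    have hs : |Real.sinh (x/2)| = Real.sinh (|x|/2) := by
      rw [Real.abs_sinh, abs_div, abs_two]
    have hc : Real.cosh (x/2) = Real.cosh (|x|/2) := by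
      rw [← Real.cosh_abs, abs_div, abs_two]
    rw [abs_div, abs_of_pos (Real.cosh_pos _), hs, hc]
    have hs0 : 0 < Real.sinh (|x|/2) := Real.sinh_pos_iff.mpr (by linarith)
    rw [div_eq_div_iff hs0.ne' (by linarith), Real.cosh_eq, Real.sinh_eq]
    have e : Real.exp (-|x|) = Real.exp (-(|x|/2)) * Real.exp (-(|x|/2)) := by
      rw [← Real.exp_add]; ring_nf
    have e' : Real.exp (|x|/2) * Real.exp (-(|x|/2)) = 1 := by
      rw [← Real.exp_add]; simp
    rw [e]
    linear_combination (-Real.exp (-(|x|/2))) * e'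

theorem fourier_transform_W_hyper (ξ : ℝ) (hξ : ξ ≠ 0) :
    (∫ x : ℝ, (Whyper x : ℂ) * Complex.exp (-Complex.I * ξ * x))
      = ((1 / (2 * ξ)) * Real.tanh (Real.pi * ξ / 2) : ℝ) := by
  set F : ℕ → ℝ → ℂ := fun n x => ((1 / (Real.pi * (2 * n + 1)) : ℝ) : ℂ) *
    ((Real.exp (-(2 * n + 1) * |x|) : ℂ) * Complex.exp (-Complex.I * ξ * x)) with hF
  have hpos : ∀ n : ℕ, (0:ℝ) < 2 * n + 1 := fun n => by positivity
  have hint : ∀ n, Integrable (F n) := fun n =>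
    (hyp_int (2 * n + 1) ξ (hpos n)).1.const_mul _
  have hval : ∀ n, ∫ x, F n x = ((2 / Real.pi * (1 / ((2 * n + 1)^2 + ξ^2)) : ℝ) : ℂ) := by
    intro n
    simp only [hF]
    rw [integral_const_mul, (hyp_int (2 * n + 1) ξ (hpos n)).2, ← Complex.ofReal_mul]
    congr 1
    have := hpos n
    have := Real.pi_pos
    field_simp
  have hnorm : ∀ n, ∫ x, ‖F n x‖ = 2 / Real.pi * (1 / (2 * n + 1)^2) := by
    intro n
    have h0 := (hyp_int (2 * n + 1) 0 (hpos n)).2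
    simp only [Complex.ofReal_zero, mul_zero, zero_mul, Complex.exp_zero, mul_one] at h0
    rw [integral_complex_ofReal] at h0
    have h0' := Complex.ofReal_injective h0
    have : ∀ x, ‖F n x‖ = (1 / (Real.pi * (2 * n + 1))) * Real.exp (-(2 * n + 1) * |x|) := by
      intro x
      simp only [hF]
      rw [norm_mul, norm_mul, Complex.norm_real, Complex.norm_real, Complex.norm_exp]
      have h1 : (-Complex.I * ξ * x : ℂ).re = 0 := by simp
      have := hpos n
      have := Real.pi_pos
      rw [h1, Real.norm_of_nonneg (by positivity), Real.norm_of_nonneg (by positivity)]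
      simp
    simp_rw [this]
    rw [integral_const_mul, h0']
    have := hpos n
    have := Real.pi_pos
    field_simp
    ring
  have hsumm : Summable fun n => ∫ x, ‖F n x‖ := by
    simp_rw [hnorm]
    refine Summable.mul_left _ ?_
    have h := (Real.summable_one_div_nat_pow (p := 2)).mpr one_lt_two
    have := h.comp_injective (i := fun n : ℕ => 2 * n + 1) (fun a b h => by simpa using h)
    convert! this using 1; ext n
    simp
  have H := hasSum_integral_of_summable_integral_norm hint hsumm
  have hae : ∫ x, ∑' n, F n x = ∫ x : ℝ, (Whyper x : ℂ) * Complex.exp (-Complex.I * ξ * x) := by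
    refine integral_congr_ae ?_
    filter_upwards [compl_mem_ae_iff.mpr (measure_singleton (0:ℝ))] with x hx
    have := ((Complex.hasSum_ofReal.mpr (hyp_W x hx)).mul_right
      (Complex.exp (-Complex.I * ξ * x))).tsum_eq
    rw [← this]
    congr 1
    ext n
    simp only [hF]
    push_cast
    ring
  rw [hae] at H
  simp_rw [hval] at H
  have H2 := Complex.hasSum_ofReal.mpr ((hyp_odd ξ hξ).mul_left (2 / Real.pi))
  rw [H.unique H2]
  congr 1
  have := Real.pi_ne_zero
  field_simp
  ring
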